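/- The image of 𝒩 under φ is φ(𝒩) = {(x₁ + i·y₁, x₂ + i·y₂) ∈ ℂ × ℂ : x₁ > 0 and x₂ = x₁² − y₂²/(4·x₁²)} (here x₁, y₁, x₂, y₂ range over ℝ). -/

import Mathlib

open Matrix Complex

/-- The tube `𝒯` over the future light cone, inside the space of symmetric
complex `2×2` matrices. -/
def lightConeTube : Set (Matrix (Fin 2) (Fin 2) ℂ) :=
  {z | zᵀ = z ∧ (z + z.map (starRingEnd ℂ)).det = 0 ∧ 0 < (Matrix.trace z).re}

/-- The future light cone `𝒞` in the space of real symmetric `2×2` matrices. -/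
def lightCone : Set (Matrix (Fin 2) (Fin 2) ℝ) :=
  {c | cᵀ = c ∧ c.det = 0 ∧ 0 < Matrix.trace c}

/-- The hypersurface `𝒩 = {c + i(rc + s·1) : c ∈ 𝒞, r, s ∈ ℝ} ⊆ 𝒯`. -/
def hypersurfN : Set (Matrix (Fin 2) (Fin 2) ℂ) :=
  {z | ∃ c ∈ lightCone, ∃ r s : ℝ,
    z = c.map (Complex.ofReal)
        + Complex.I • ((r • c + s • (1 : Matrix (Fin 2) (Fin 2) ℝ)).map (Complex.ofReal))}

/-- The complement `𝒲 = 𝒯 \ 𝒩`. -/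
def openW : Set (Matrix (Fin 2) (Fin 2) ℂ) := lightConeTube \ hypersurfN

/-- The `SO(2)`-invariant holomorphic map `φ(z) = (tr z, tr(z²) − (tr z)²)`,
with `tr` the normalized trace. -/
noncomputable def phiMap (z : Matrix (Fin 2) (Fin 2) ℂ) : ℂ × ℂ :=
  (Matrix.trace z / 2, Matrix.trace (z * z) / 2 - (Matrix.trace z / 2) ^ 2)

/-- The value of `φ` on a point of `𝒩`, in terms of its parameters. -/
lemma phiMap_param (c : Matrix (Fin 2) (Fin 2) ℝ) (hc : c ∈ lightCone) (r s : ℝ) :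
    phiMap (c.map (Complex.ofReal)
        + Complex.I • ((r • c + s • (1 : Matrix (Fin 2) (Fin 2) ℝ)).map (Complex.ofReal)))
      = (⟨c.trace / 2, r * (c.trace / 2) + s⟩,
         ⟨(c.trace / 2) ^ 2 * (1 - r ^ 2), 2 * r * (c.trace / 2) ^ 2⟩) := by
  obtain ⟨h1, h2, -⟩ := hc
  have h10 : c 1 0 = c 0 1 := by
    have := congrFun (congrFun h1 0) 1
    simpa using this
  rw [Matrix.det_fin_two, h10] at h2
  have h2c : (c 0 1 : ℂ) * c 0 1 = c 0 0 * c 1 1 := by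
    have : c 0 1 * c 0 1 = c 0 0 * c 1 1 := by linarith
    exact_mod_cast this
  have hI : Complex.I * Complex.I = -1 := Complex.I_mul_I
  refine Prod.ext ?_ ?_
  · simp only [phiMap, Complex.mk_eq_add_mul_I]
    simp [Matrix.trace_fin_two]
    ring
  · simp only [phiMap, Complex.mk_eq_add_mul_I]
    simp [Matrix.trace_fin_two, Matrix.mul_apply, Fin.sum_univ_two, h10]
    linear_combination (1 + Complex.I * r) ^ 2 * h2c
      + (((c 0 0 + c 1 1 : ℂ) / 2) ^ 2 * r ^ 2) * hI

/-- The image of `𝒩` under `φ`. -/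
theorem phi_image_N :
    phiMap '' hypersurfN =
      {p : ℂ × ℂ | 0 < p.1.re ∧ p.2.re = p.1.re ^ 2 - p.2.im ^ 2 / (4 * p.1.re ^ 2)} := by
  ext p
  constructor
  · rintro ⟨z, ⟨c, hc, r, s, rfl⟩, rfl⟩
    rw [phiMap_param c hc]
    have ht : 0 < c.trace := hc.2.2
    refine ⟨by simpa using ht, ?_⟩
    simp only
    field_simp
    ring
  · rintro ⟨hx, h2⟩
    have hc : !![2 * p.1.re, 0; 0, 0] ∈ lightCone := by
      refine ⟨?_, ?_, ?_⟩
      · ext i j; fin_cases i <;> fin_cases j <;> simp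
      · simp [Matrix.det_fin_two]
      · simpa [Matrix.trace_fin_two] using hx
    refine ⟨_, ⟨_, hc, p.2.im / (2 * p.1.re ^ 2),
      p.1.im - p.2.im / (2 * p.1.re ^ 2) * p.1.re, rfl⟩, ?_⟩
    rw [phiMap_param _ hc]
    have ht : (!![2 * p.1.re, 0; 0, 0] : Matrix (Fin 2) (Fin 2) ℝ).trace / 2 = p.1.re := by
      simp [Matrix.trace_fin_two]
    rw [ht]
    have hx' := hx.ne'
    refine Prod.ext (Complex.ext rfl ?_) (Complex.ext ?_ ?_)
    · simp only
      ring
    · simp only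
      rw [h2]
      field_simp
      ring
    · simp only
      field_simp
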